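/- If Austria at least draws against France (a ≥ f), then for every outcome (x, y) of the Iceland–Greece match, each of Greece and Iceland satisfies exactly one of the following: (i) it finishes with strictly fewer points than at least two other teams of the group (so it is not the group winner or runner-up), or (ii) it is the unique second-placed team (which happens only when a = f and it wins the Iceland–Greece match), in which case its runner-up record from its matches against France and Austria is (1 point, goal difference −1, 0 goals scored), lexicographically strictly below Poland's record (1, −1, 1). Hence in every case Greece and Iceland are both eliminated. -/

import Mathlib

/-- The four teams of Group 6. -/
inductive Team : Type
  | France | Austria | Greece | Iceland
  deriving DecidableEq

open Team

/-- Points of team `t` from its matches against the opponents in `opps`,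
given the goals function `g` (3 for a win, 1 for a draw, 0 for a loss). -/
def pts (g : Team → Team → ℕ) (opps : Finset Team) (t : Team) : ℕ :=
  ∑ s ∈ opps, (if g s t < g t s then 3 else if g t s = g s t then 1 else 0)

/-- Goal difference of team `t` over the matches against the opponents in `opps`. -/
def gd (g : Team → Team → ℕ) (opps : Finset Team) (t : Team) : ℤ :=
  ∑ s ∈ opps, ((g t s : ℤ) - (g s t : ℤ))

/-- Goals scored by team `t` against the opponents in `opps`. -/
def gf (g : Team → Team → ℕ) (opps : Finset Team) (t : Team) : ℕ :=
  ∑ s ∈ opps, g t s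

/-- The three opponents of a team in the round-robin group. -/
def oppsOf : Team → Finset Team
  | France => {Austria, Greece, Iceland}
  | Austria => {France, Greece, Iceland}
  | Greece => {France, Austria, Iceland}
  | Iceland => {France, Austria, Greece}

/-- A runner-up record: (points, goal difference, goals scored). -/
def record (g : Team → Team → ℕ) (opps : Finset Team) (t : Team) : ℕ × ℤ × ℕ :=
  (pts g opps t, gd g opps t, gf g opps t)

/-- Lexicographic strict comparison of records:
higher points first, then higher goal difference, then more goals scored. -/
def recLT (r s : ℕ × ℤ × ℕ) : Prop :=
  r.1 < s.1 ∨ (r.1 = s.1 ∧ (r.2.1 < s.2.1 ∨ (r.2.1 = s.2.1 ∧ r.2.2 < s.2.2)))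

/-- Poland's runner-up record: 1 point, goal difference −1, 1 goal scored. -/
def poland : ℕ × ℤ × ℕ := (1, -1, 1)

theorem Team.exists_iff {p : Team → Prop} :
    (∃ t, p t) ↔ p France ∨ p Austria ∨ p Greece ∨ p Iceland := by
  constructor
  · rintro ⟨t, ht⟩
    cases t <;> simp [ht]
  · rintro (h | h | h | h) <;> exact ⟨_, h⟩

theorem Team.forall_iff {p : Team → Prop} :
    (∀ t, p t) ↔ p France ∧ p Austria ∧ p Greece ∧ p Iceland :=
  ⟨fun h => ⟨h _, h _, h _, h _⟩, by rintro ⟨hF, hA, hG, hI⟩ (_ | _ | _ | _) <;> assumption⟩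

theorem greece_iceland_always_eliminated (g : Team → Team → ℕ) (f a x y : ℕ)
    (hdiag : ∀ t, g t t = 0)
    (hFG : g France Greece = 1) (hGF : g Greece France = 0)
    (hAI : g Austria Iceland = 0) (hIA : g Iceland Austria = 0)
    (hFI : g France Iceland = 1) (hIF : g Iceland France = 0)
    (hGA : g Greece Austria = 0) (hAG : g Austria Greece = 0)
    (hFA : g France Austria = f) (hAF : g Austria France = a)
    (hIG : g Iceland Greece = y) (hGI : g Greece Iceland = x)
    (hge : f ≤ a) :
    ∀ t ∈ ({Greece, Iceland} : Finset Team),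
      Xor'
        -- (i) strictly fewer points than at least two other teams
        (∃ s u, s ≠ u ∧ s ≠ t ∧ u ≠ t ∧
          pts g (oppsOf t) t < pts g (oppsOf s) s ∧
          pts g (oppsOf t) t < pts g (oppsOf u) u)
        -- (ii) unique second-placed team, with record strictly below Poland's
        ((∃ s, s ≠ t ∧ pts g (oppsOf t) t < pts g (oppsOf s) s ∧
            ∀ u, u ≠ t → u ≠ s → pts g (oppsOf u) u < pts g (oppsOf t) t) ∧
          f = a ∧
          (t = Greece → y < x) ∧ (t = Iceland → x < y) ∧
          record g {France, Austria} t = (1, -1, 0) ∧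
          recLT (record g {France, Austria} t) poland) := by
  have hF : pts g (oppsOf France) France = (if a < f then 3 else if f = a then 1 else 0) + 6 := by
    simp [pts, oppsOf, *]
  have hA : pts g (oppsOf Austria) Austria = (if f < a then 3 else if a = f then 1 else 0) + 2 := by
    simp [pts, oppsOf, *]
  have hG : pts g (oppsOf Greece) Greece = 1 + (if y < x then 3 else if x = y then 1 else 0) := by
    simp [pts, oppsOf, *]
  have hI : pts g (oppsOf Iceland) Iceland = 1 + (if x < y then 3 else if y = x then 1 else 0) := by
    simp [pts, oppsOf, *]
  have hrG : record g {France, Austria} Greece = (1, -1, 0) := by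
    simp [record, pts, gd, gf, *]
  have hrI : record g {France, Austria} Iceland = (1, -1, 0) := by
    simp [record, pts, gd, gf, *]
  have hlt : recLT (1, -1, 0) poland := by simp [recLT, poland]
  simp only [Finset.mem_insert, Finset.mem_singleton, forall_eq_or_imp, forall_eq, hrG, hrI, hlt,
    Team.exists_iff, Team.forall_iff, hF, hA, hG, hI, ne_eq, reduceCtorEq, not_true_eq_false,
    not_false_eq_true, true_and, and_true, false_and, and_false, false_or, or_false, true_implies,
    false_implies]
  clear hF hA hG hI
  constructor <;> change (_ ∧ ¬_) ∨ (_ ∧ ¬_) <;> split_ifs <;> omega
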